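/- Let K ⊆ ℝ^d (d ≥ 2) be a closed convex set with non-empty interior, and let α ∈ ℝ^d with α ≠ 0 be such that K ∩ {x : αᵀx ≤ t} is compact for all t ∈ ℝ. Then the function t ↦ μ_{d−1}(K ∩ {x : αᵀx = t})^{1/(d−1)} is concave on the open interval (inf_{x∈K} αᵀx, sup_{x∈K} αᵀx), where μ_{d−1} denotes (d−1)-dimensional Lebesgue measure on the hyperplane {x : αᵀx = t}. -/

import Mathlib

open MeasureTheory
open scoped RealInnerProductSpace

open Set Pointwise in
theorem bm1_compact {A B C : Set ℝ} (hA : IsCompact A) (hB : IsCompact B)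
    (hA0 : A.Nonempty) (hB0 : B.Nonempty) {a b : ℝ} (ha : 0 < a) (hb : 0 < b)
    (h : ∀ x ∈ A, ∀ y ∈ B, a * x + b * y ∈ C) :
    ENNReal.ofReal a * volume A + ENNReal.ofReal b * volume B ≤ volume C := by
  obtain ⟨p, hp, hpm⟩ := hA.exists_isGreatest hA0
  obtain ⟨q, hq, hqm⟩ := hB.exists_isLeast hB0
  have e1 : volume ((fun x => x + b * q) '' (a • A)) = ENNReal.ofReal a * volume A := by
    rw [image_add_right, measure_preimage_add_right, Measure.addHaar_smul]
    simp [abs_of_pos ha]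
  have e2 : volume ((fun x => x + a * p) '' (b • B)) = ENNReal.ofReal b * volume B := by
    rw [image_add_right, measure_preimage_add_right, Measure.addHaar_smul]
    simp [abs_of_pos hb]
  rw [← e1, ← e2]
  have mB : MeasurableSet ((fun x => x + a * p) '' (b • B)) :=
    ((hB.smul b).image (by fun_prop)).measurableSet
  rw [← measure_union₀ mB.nullMeasurableSet]
  · apply measure_mono
    rintro z (⟨_, ⟨x, hx, rfl⟩, rfl⟩ | ⟨_, ⟨x, hx, rfl⟩, rfl⟩)
    · exact h x hx q hq
    · simpa [add_comm] using h p hp x hx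
  · apply measure_mono_null (t := {a * p + b * q}) _ (by simp)
    rintro z ⟨⟨_, ⟨x, hx, rfl⟩, rfl⟩, ⟨_, ⟨y, hy, rfl⟩, hxy⟩⟩
    have h1 : a * x ≤ a * p := mul_le_mul_of_nonneg_left (hpm hx) ha.le
    have h2 : b * q ≤ b * y := mul_le_mul_of_nonneg_left (hqm hy) hb.le
    simp only [smul_eq_mul, mem_singleton_iff] at *
    linarith

open Set Pointwise in
theorem bm1 {A B C : Set ℝ} (hA : MeasurableSet A) (hB : MeasurableSet B)
    (hA0 : A.Nonempty) (hB0 : B.Nonempty) {a b : ℝ} (ha : 0 < a) (hb : 0 < b)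
    (h : ∀ x ∈ A, ∀ y ∈ B, a * x + b * y ∈ C) :
    ENNReal.ofReal a * volume A + ENNReal.ofReal b * volume B ≤ volume C := by
  obtain ⟨p, hp⟩ := hA0
  obtain ⟨q, hq⟩ := hB0
  rw [hA.measure_eq_iSup_isCompact, hB.measure_eq_iSup_isCompact]
  simp only [ENNReal.mul_iSup, iSup_and']
  have key : ∀ A' ⊆ A, IsCompact A' → ∀ B' ⊆ B, IsCompact B' →
      ENNReal.ofReal a * volume A' + ENNReal.ofReal b * volume B' ≤ volume C := by
    intro A' hA' cA B' hB' cB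
    refine le_trans ?_ (bm1_compact (cA.insert p) (cB.insert q) (by simp) (by simp) ha hb
      (C := C) ?_)
    · gcongr <;> simp
    · intro x hx y hy
      exact h x (insert_subset hp hA' hx) y (insert_subset hq hB' hy)
  exact ENNReal.biSup_add_biSup_le' ⟨∅, by simp⟩ ⟨∅, by simp⟩
    fun A' hA' B' hB' => key A' hA'.1 hA'.2 B' hB'.1 hB'.2

theorem layer1 {f : ℝ → ENNReal} (hf : Measurable f) (h1 : ∀ x, f x ≤ 1) :
    ∫⁻ x, f x = ∫⁻ t in Set.Ioo (0:ℝ) 1, volume {x | ENNReal.ofReal t < f x} := by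
  have h := lintegral_eq_lintegral_meas_lt (f := fun x => (f x).toReal) volume
    (Filter.Eventually.of_forall fun x => ENNReal.toReal_nonneg) hf.ennreal_toReal.aemeasurable
  have ht : ∀ x, f x ≠ ⊤ := fun x => ((h1 x).trans_lt ENNReal.one_lt_top).ne
  simp only [ENNReal.ofReal_toReal (ht _)] at h
  rw [h]
  have : Set.Ioi (0:ℝ) = Set.Ioo 0 1 ∪ Set.Ici 1 := by
    ext x; simp only [Set.mem_Ioi, Set.mem_union, Set.mem_Ioo, Set.mem_Ici]; constructor
    · intro hx; by_cases h : x < 1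
      · exact Or.inl ⟨hx, h⟩
      · exact Or.inr (not_lt.1 h)
    · rintro (h | h)
      · exact h.1
      · linarith
  rw [this, lintegral_union measurableSet_Ici]
  · have : ∫⁻ t in Set.Ici (1:ℝ), volume {a | t < (f a).toReal} = 0 := by
      rw [setLIntegral_congr_fun (g := fun _ => 0) measurableSet_Ici]
      · simp
      · intro t ht'
        have : {a | t < (f a).toReal} = ∅ := by
          ext x
          simp only [Set.mem_ofPred_eq, Set.mem_empty_iff_false, iff_false, not_lt]
          refine le_trans ?_ ht'
          exact ENNReal.toReal_le_of_le_ofReal zero_le_one (by simpa using h1 x)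
        simp [this]
    rw [this, add_zero]
    refine setLIntegral_congr_fun measurableSet_Ioo fun t ht' => ?_
    congr 1
    ext x
    simp [ENNReal.ofReal_lt_iff_lt_toReal ht'.1.le (ht x)]
  · rw [Set.disjoint_left]
    intro x hx hx'
    exact absurd hx.2 (not_lt.2 hx')

theorem amgm {a b : ℝ} (ha : 0 < a) (hb : 0 < b) (hab : a + b = 1) (x y : ENNReal) :
    x ^ a * y ^ b ≤ ENNReal.ofReal a * x + ENNReal.ofReal b * y := by
  have ha' : ENNReal.ofReal a ≠ 0 := by simpa using ha
  have hb' : ENNReal.ofReal b ≠ 0 := by simpa using hb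
  by_cases hx : x = ⊤
  · simp [hx, ENNReal.mul_top ha']
  by_cases hy : y = ⊤
  · simp [hy, ENNReal.mul_top hb']
  lift x to NNReal using hx
  lift y to NNReal using hy
  have := NNReal.geom_mean_le_arith_mean2_weighted ⟨a, ha.le⟩ ⟨b, hb.le⟩ x y (by ext; exact hab)
  rw [← ENNReal.coe_rpow_of_nonneg _ ha.le, ← ENNReal.coe_rpow_of_nonneg _ hb.le,
    ENNReal.ofReal_eq_coe_nnreal ha.le, ENNReal.ofReal_eq_coe_nnreal hb.le]
  exact_mod_cast this

theorem pl1_norm {f g h : ℝ → ENNReal} (hf : Measurable f) (hg : Measurable g) (hh : Measurable h)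
    {a b : ℝ} (ha : 0 < a) (hb : 0 < b) (hab : a + b = 1)
    (f1 : ⨆ x, f x = 1) (g1 : ⨆ x, g x = 1)
    (H : ∀ x y, f x ^ a * g y ^ b ≤ h (a * x + b * y)) :
    (∫⁻ x, f x) ^ a * (∫⁻ x, g x) ^ b ≤ ∫⁻ x, h x := by
  refine (amgm ha hb hab _ _).trans ?_
  have hf' : ∀ x, f x ≤ 1 := fun x => f1 ▸ le_iSup f x
  have hg' : ∀ x, g x ≤ 1 := fun x => g1 ▸ le_iSup g x
  calc _ ≤ ∫⁻ x, min (h x) 1 := ?_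
    _ ≤ _ := lintegral_mono fun x => min_le_left _ _
  have mm : ∀ f : ℝ → ENNReal, Measurable fun t : ℝ => volume {x | ENNReal.ofReal t < f x} := by
    intro f
    refine Antitone.measurable fun s t hst => measure_mono fun x hx => ?_
    exact (ENNReal.ofReal_le_ofReal hst).trans_lt hx
  rw [layer1 hf hf', layer1 hg hg', layer1 (hh.min measurable_const) (fun x => min_le_right _ _),
    ← lintegral_const_mul _ (mm f), ← lintegral_const_mul _ (mm g),
    ← lintegral_add_left ((mm f).const_mul _)]
  refine setLIntegral_mono' measurableSet_Ioo fun t ht => ?_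
  have t1 : ENNReal.ofReal t < 1 := by simpa using ht.2
  refine bm1 (measurableSet_lt measurable_const hf) (measurableSet_lt measurable_const hg)
    (Set.nonempty_def.2 (lt_iSup_iff.1 (t1.trans_eq f1.symm)))
    (Set.nonempty_def.2 (lt_iSup_iff.1 (t1.trans_eq g1.symm))) ha hb ?_
  intro x hx y hy
  refine lt_min ?_ t1
  refine lt_of_lt_of_le ?_ (H x y)
  have t0 : ENNReal.ofReal t ≠ 0 := by simpa using ht.1
  calc ENNReal.ofReal t = ENNReal.ofReal t ^ a * ENNReal.ofReal t ^ b := by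
        rw [← ENNReal.rpow_add _ _ t0 (by simp), hab, ENNReal.rpow_one]
    _ < _ := ENNReal.mul_lt_mul (ENNReal.rpow_lt_rpow hx ha) (ENNReal.rpow_lt_rpow hy hb)

theorem pl1_bdd {f g h : ℝ → ENNReal} (hf : Measurable f) (hg : Measurable g) (hh : Measurable h)
    {a b : ℝ} (ha : 0 < a) (hb : 0 < b) (hab : a + b = 1)
    (f1 : ⨆ x, f x ≠ ⊤) (g1 : ⨆ x, g x ≠ ⊤)
    (H : ∀ x y, f x ^ a * g y ^ b ≤ h (a * x + b * y)) :
    (∫⁻ x, f x) ^ a * (∫⁻ x, g x) ^ b ≤ ∫⁻ x, h x := by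
  set F := ⨆ x, f x with hF
  set G := ⨆ x, g x with hG
  by_cases F0 : F = 0
  · have : ∀ x, f x = 0 := fun x => le_antisymm (F0 ▸ le_iSup f x) zero_le
    simp [this, ENNReal.zero_rpow_of_pos ha]
  by_cases G0 : G = 0
  · have : ∀ x, g x = 0 := fun x => le_antisymm (G0 ▸ le_iSup g x) zero_le
    simp [this, ENNReal.zero_rpow_of_pos hb]
  have key := pl1_norm (f := fun x => F⁻¹ * f x) (g := fun x => G⁻¹ * g x)
    (h := fun x => (F⁻¹ ^ a * G⁻¹ ^ b) * h x) (by fun_prop) (by fun_prop) (by fun_prop) ha hb hab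
    (by rw [← ENNReal.mul_iSup, ENNReal.inv_mul_cancel F0 f1])
    (by rw [← ENNReal.mul_iSup, ENNReal.inv_mul_cancel G0 g1])
    (by
      intro x y
      rw [ENNReal.mul_rpow_of_nonneg _ _ ha.le, ENNReal.mul_rpow_of_nonneg _ _ hb.le,
        mul_mul_mul_comm]
      gcongr
      exact H x y)
  rw [lintegral_const_mul _ hf, lintegral_const_mul _ hg, lintegral_const_mul _ hh,
    ENNReal.mul_rpow_of_nonneg _ _ ha.le, ENNReal.mul_rpow_of_nonneg _ _ hb.le,
    mul_mul_mul_comm] at key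
  refine (ENNReal.mul_le_mul_iff_right ?_ ?_).1 key
  · simp [ha, hb, F0, G0, f1, g1, not_lt.2 ha.le, not_lt.2 hb.le]
  · apply ENNReal.mul_ne_top <;> apply ENNReal.rpow_ne_top_of_nonneg <;>
      first | exact ha.le | exact hb.le | exact ENNReal.inv_ne_top.2 F0 | exact ENNReal.inv_ne_top.2 G0

theorem trunc {f : ℝ → ENNReal} (hf : Measurable f) {a : ℝ} (ha : 0 < a) :
    (∫⁻ x, f x) ^ a = ⨆ n : ℕ, (∫⁻ x, min (f x) n) ^ a := by
  have : ∀ x, f x = ⨆ n : ℕ, min (f x) n := by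
    intro x
    rw [← inf_iSup_eq (f x) (fun n : ℕ => (n : ENNReal)), ENNReal.iSup_natCast]; simp
  conv_lhs => enter [1, 2, x]; rw [this x]
  rw [lintegral_iSup (fun n => by fun_prop)]
  · exact (ENNReal.orderIsoRpow a ha).map_iSup _
  · intro m n hmn x
    simp only
    gcongr

theorem pl1 {f g h : ℝ → ENNReal} (hf : Measurable f) (hg : Measurable g) (hh : Measurable h)
    {a b : ℝ} (ha : 0 < a) (hb : 0 < b) (hab : a + b = 1)
    (H : ∀ x y, f x ^ a * g y ^ b ≤ h (a * x + b * y)) :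
    (∫⁻ x, f x) ^ a * (∫⁻ x, g x) ^ b ≤ ∫⁻ x, h x := by
  rw [trunc hf ha, trunc hg hb, ENNReal.iSup_mul]
  refine iSup_le fun m => ?_
  rw [ENNReal.mul_iSup]
  refine iSup_le fun n => ?_
  refine pl1_bdd (by fun_prop) (by fun_prop) hh ha hb hab ?_ ?_ ?_
  · exact ((iSup_le fun x => min_le_right _ _).trans_lt (ENNReal.natCast_lt_top m)).ne
  · exact ((iSup_le fun x => min_le_right _ _).trans_lt (ENNReal.natCast_lt_top n)).ne
  · intro x y
    refine le_trans ?_ (H x y)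
    gcongr <;> exact min_le_left _ _

theorem pl (n : ℕ) : ∀ {f g h : (Fin n → ℝ) → ENNReal} (_ : Measurable f) (_ : Measurable g)
    (_ : Measurable h) {a b : ℝ} (_ : 0 < a) (_ : 0 < b) (_ : a + b = 1)
    (_ : ∀ x y, f x ^ a * g y ^ b ≤ h (a • x + b • y)),
    (∫⁻ x, f x) ^ a * (∫⁻ x, g x) ^ b ≤ ∫⁻ x, h x := by
  induction n with
  | zero =>
    intro f g h hf hg hh a b ha hb hab H
    rw [Measure.volume_pi_eq_dirac]
    rw [lintegral_dirac' _ hf, lintegral_dirac' _ hg, lintegral_dirac' _ hh]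
    refine (H _ _).trans (le_of_eq ?_)
    congr 1
    exact Subsingleton.elim _ _
  | succ n ih =>
    intro f g h hf hg hh a b ha hb hab H
    let e := MeasurableEquiv.piFinSuccAbove (fun _ : Fin (n+1) => ℝ) 0
    have he : MeasurePreserving e.symm (volume.prod volume) volume :=
      (volume_preserving_piFinSuccAbove (fun _ : Fin (n+1) => ℝ) 0).symm
    have key : ∀ {f : (Fin (n+1) → ℝ) → ENNReal}, Measurable f →
        ∫⁻ x, f x = ∫⁻ s : ℝ, ∫⁻ y : Fin n → ℝ, f (e.symm (s, y)) := by
      intro f hf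
      rw [← he.lintegral_comp hf, lintegral_prod]
      exact (hf.comp e.symm.measurable).aemeasurable
    have km : ∀ {f : (Fin (n+1) → ℝ) → ENNReal}, Measurable f →
        Measurable fun s : ℝ => ∫⁻ y : Fin n → ℝ, f (e.symm (s, y)) := by
      intro f hf
      exact (hf.comp e.symm.measurable).lintegral_prod_right'
    rw [key hf, key hg, key hh]
    refine pl1 (km hf) (km hg) (km hh) ha hb hab fun s t => ?_
    refine ih (hf.comp (e.symm.measurable.comp measurable_prodMk_left))
      (hg.comp (e.symm.measurable.comp measurable_prodMk_left))
      (hh.comp (e.symm.measurable.comp measurable_prodMk_left)) ha hb hab fun x y => ?_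
    refine (H _ _).trans (le_of_eq ?_)
    simp only [Function.comp]
    congr 1
    ext i
    refine Fin.cases ?_ (fun j => ?_) i <;> simp [e, MeasurableEquiv.piFinSuccAbove, Fin.insertNthEquiv]

open Pointwise in
theorem scale_vol {n : ℕ} (hn : 0 < n) {r : ℝ} (hr : 0 ≤ r) (S : Set (Fin n → ℝ)) :
    volume (r • S) ^ ((1:ℝ) / n) = ENNReal.ofReal r * volume S ^ ((1:ℝ) / n) := by
  rw [Measure.addHaar_smul, abs_of_nonneg (pow_nonneg hr _),
    ENNReal.mul_rpow_of_nonneg _ _ (by positivity), ENNReal.ofReal_pow hr, Module.finrank_fin_fun,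
    ← ENNReal.rpow_natCast, ← ENNReal.rpow_mul, mul_one_div_cancel (by positivity),
    ENNReal.rpow_one]

open Pointwise in
theorem bm_degen {n : ℕ} (hn : 0 < n) {A B C : Set (Fin n → ℝ)} (hA0 : A.Nonempty)
    {a b : ℝ} (hb : 0 < b) (h : ∀ x ∈ A, ∀ y ∈ B, a • x + b • y ∈ C) :
    ENNReal.ofReal b * volume B ^ ((1:ℝ) / n) ≤ volume C ^ ((1:ℝ) / n) := by
  obtain ⟨p, hp⟩ := hA0
  rw [← scale_vol hn hb.le]
  gcongr ?_ ^ _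
  rw [← measure_preimage_add volume (-(a • p)) (b • B)]
  apply measure_mono
  rintro z ⟨y, hy, hz⟩
  have : z = a • p + b • y := by simp only at hz; rw [hz]; abel
  exact this ▸ h p hp y hy

open Pointwise in
theorem bm_vol {n : ℕ} (hn : 0 < n) {A B C : Set (Fin n → ℝ)} (hA : MeasurableSet A)
    (hB : MeasurableSet B) (hC : MeasurableSet C) (hA0 : A.Nonempty) (hB0 : B.Nonempty)
    (hAt : volume A ≠ ⊤) (hBt : volume B ≠ ⊤)
    {a b : ℝ} (ha : 0 < a) (hb : 0 < b) 
    (h : ∀ x ∈ A, ∀ y ∈ B, a • x + b • y ∈ C) :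
    ENNReal.ofReal a * volume A ^ ((1:ℝ) / n) + ENNReal.ofReal b * volume B ^ ((1:ℝ) / n)
      ≤ volume C ^ ((1:ℝ) / n) := by
  have hn' : (0:ℝ) < 1 / n := by positivity
  by_cases A0 : volume A = 0
  · rw [A0, ENNReal.zero_rpow_of_pos hn', mul_zero, zero_add]
    exact bm_degen hn hA0 hb h
  by_cases B0 : volume B = 0
  · rw [B0, ENNReal.zero_rpow_of_pos hn', mul_zero, add_zero]
    exact bm_degen hn hB0 ha (C := C) (a := b) (fun x hx y hy => by rw [add_comm]; exact h y hy x hx)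
  have hAr : volume A ^ ((1:ℝ) / n) ≠ ⊤ := ENNReal.rpow_ne_top_of_nonneg hn'.le hAt
  have hBr : volume B ^ ((1:ℝ) / n) ≠ ⊤ := ENNReal.rpow_ne_top_of_nonneg hn'.le hBt
  have hAr0 : volume A ^ ((1:ℝ) / n) ≠ 0 := (ENNReal.rpow_pos (pos_iff_ne_zero.2 A0) hAt).ne'
  have hBr0 : volume B ^ ((1:ℝ) / n) ≠ 0 := (ENNReal.rpow_pos (pos_iff_ne_zero.2 B0) hBt).ne'
  obtain ⟨u, hu⟩ : ∃ u, u = (volume A ^ ((1:ℝ) / n)).toReal := ⟨_, rfl⟩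
  obtain ⟨v, hv⟩ : ∃ v, v = (volume B ^ ((1:ℝ) / n)).toReal := ⟨_, rfl⟩
  have u0 : 0 < u := hu ▸ ENNReal.toReal_pos hAr0 hAr
  have v0 : 0 < v := hv ▸ ENNReal.toReal_pos hBr0 hBr
  have hu' : volume A ^ ((1:ℝ) / n) = ENNReal.ofReal u := by rw [hu, ENNReal.ofReal_toReal hAr]
  have hv' : volume B ^ ((1:ℝ) / n) = ENNReal.ofReal v := by rw [hv, ENNReal.ofReal_toReal hBr]
  have one : ∀ {S : Set (Fin n → ℝ)} {u : ℝ}, 0 < u → volume S ^ ((1:ℝ) / n) = ENNReal.ofReal u →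
      volume (u⁻¹ • S) = 1 := by
    intro S u u0 hS
    have := scale_vol hn (inv_nonneg.2 u0.le) S
    rw [hS, ← ENNReal.ofReal_mul (inv_nonneg.2 u0.le), inv_mul_cancel₀ u0.ne',
      ENNReal.ofReal_one] at this
    exact (ENNReal.rpow_left_injective hn'.ne') (by simpa using this)
  obtain ⟨s, hs⟩ : ∃ s, s = a * u + b * v := ⟨_, rfl⟩
  have s0 : 0 < s := by rw [hs]; positivity
  have mA : MeasurableSet (u⁻¹ • A) := hA.const_smul_of_ne_zero (inv_ne_zero u0.ne')
  have mB : MeasurableSet (v⁻¹ • B) := hB.const_smul_of_ne_zero (inv_ne_zero v0.ne')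
  have mC : MeasurableSet (s⁻¹ • C) := hC.const_smul_of_ne_zero (inv_ne_zero s0.ne')
  have p1 : 0 < a * u / s := by positivity
  have p2 : 0 < b * v / s := by positivity
  have key := pl n (f := (u⁻¹ • A).indicator 1) (g := (v⁻¹ • B).indicator 1)
    (h := (s⁻¹ • C).indicator 1) (measurable_one.indicator mA)
    (measurable_one.indicator mB) (measurable_one.indicator mC) p1 p2
    (by rw [← add_div, ← hs, div_self s0.ne']) (by
      intro x y
      by_cases hx : x ∈ u⁻¹ • A
      · by_cases hy : y ∈ v⁻¹ • B
        · have : (a * u / s) • x + (b * v / s) • y ∈ s⁻¹ • C := by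
            obtain ⟨x, hx, rfl⟩ := hx
            obtain ⟨y, hy, rfl⟩ := hy
            refine ⟨_, h x hx y hy, ?_⟩
            simp only [smul_add, smul_smul]
            congr 2 <;> field_simp
          simp [hx, hy, this]
        · simp [hy, ENNReal.zero_rpow_of_pos p2]
      · simp [hx, ENNReal.zero_rpow_of_pos p1])
  rw [lintegral_indicator_one mA, lintegral_indicator_one mB, lintegral_indicator_one mC,
    one u0 hu', one v0 hv', ENNReal.one_rpow, ENNReal.one_rpow, one_mul] at key
  have k2 := ENNReal.rpow_le_rpow key hn'.le
  rw [ENNReal.one_rpow, scale_vol hn (inv_nonneg.2 s0.le)] at k2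
  rw [hu', hv', ← ENNReal.ofReal_mul ha.le, ← ENNReal.ofReal_mul hb.le,
    ← ENNReal.ofReal_add (by positivity) (by positivity), ← hs]
  calc ENNReal.ofReal s = ENNReal.ofReal s * 1 := (mul_one _).symm
    _ ≤ ENNReal.ofReal s * (ENNReal.ofReal s⁻¹ * volume C ^ ((1:ℝ) / n)) := by gcongr
    _ = _ := by
      rw [← mul_assoc, ← ENNReal.ofReal_mul s0.le, mul_inv_cancel₀ s0.ne', ENNReal.ofReal_one,
        one_mul]

theorem bm_haar {n : ℕ} (hn : 0 < n) (μ : Measure (Fin n → ℝ)) [μ.IsAddHaarMeasure]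
    {A B C : Set (Fin n → ℝ)} (hA : IsCompact A)
    (hB : IsCompact B) (hC : IsCompact C) (hA0 : A.Nonempty) (hB0 : B.Nonempty)
    {a b : ℝ} (ha : 0 < a) (hb : 0 < b) 
    (h : ∀ x ∈ A, ∀ y ∈ B, a • x + b • y ∈ C) :
    a * (μ A).toReal ^ ((1:ℝ) / n) + b * (μ B).toReal ^ ((1:ℝ) / n)
      ≤ (μ C).toReal ^ ((1:ℝ) / n) := by
  have hn' : (0:ℝ) ≤ 1 / n := by positivity
  have key := bm_vol hn hA.measurableSet hB.measurableSet hC.measurableSet hA0 hB0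
    hA.measure_lt_top.ne hB.measure_lt_top.ne ha hb h
  have key2 := ENNReal.toReal_mono (ENNReal.rpow_ne_top_of_nonneg hn' hC.measure_lt_top.ne) key
  rw [ENNReal.toReal_add
    (ENNReal.mul_ne_top (by simp) (ENNReal.rpow_ne_top_of_nonneg hn' hA.measure_lt_top.ne))
    (ENNReal.mul_ne_top (by simp) (ENNReal.rpow_ne_top_of_nonneg hn' hB.measure_lt_top.ne)),
    ENNReal.toReal_mul, ENNReal.toReal_mul, ENNReal.toReal_ofReal ha.le,
    ENNReal.toReal_ofReal hb.le, ← ENNReal.toReal_rpow, ← ENNReal.toReal_rpow,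
    ← ENNReal.toReal_rpow] at key2
  rw [Measure.isAddLeftInvariant_eq_smul μ volume]
  simp only [Measure.smul_apply, ENNReal.toReal_smul, NNReal.smul_def, smul_eq_mul]
  rw [Real.mul_rpow (by positivity) (by positivity), Real.mul_rpow (by positivity) (by positivity),
    Real.mul_rpow (by positivity) (by positivity)]
  refine le_trans (le_of_eq ?_) (mul_le_mul_of_nonneg_left key2 (by positivity))
  ring

theorem section_nonempty {E : Type*} [NormedAddCommGroup E] [InnerProductSpace ℝ E] {K : Set E}
    (hconv : Convex ℝ K) (α : E) {t : ℝ}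
    (ht : (∃ x ∈ K, ⟪α, x⟫ < t) ∧ ∃ x ∈ K, t < ⟪α, x⟫) : ∃ x ∈ K, ⟪α, x⟫ = t := by
  obtain ⟨⟨x, hx, hxt⟩, ⟨y, hy, hyt⟩⟩ := ht
  have := hconv.isPreconnected.intermediate_value hx hy (f := fun x => ⟪α, x⟫) (by fun_prop)
    ⟨hxt.le, hyt.le⟩
  exact this

theorem stmt_7 (d : ℕ) (hd : 2 ≤ d) (K : Set (EuclideanSpace ℝ (Fin d)))
    (hcl : IsClosed K) (hconv : Convex ℝ K) (hint : (interior K).Nonempty)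
    (α : EuclideanSpace ℝ (Fin d)) (hα : α ≠ 0)
    (hcompact : ∀ t : ℝ, IsCompact (K ∩ {x | ⟪α, x⟫ ≤ t})) :
    ConcaveOn ℝ {t : ℝ | (∃ x ∈ K, ⟪α, x⟫ < t) ∧ ∃ x ∈ K, t < ⟪α, x⟫}
      (fun t : ℝ =>
        (Measure.hausdorffMeasure ((d : ℝ) - 1) (K ∩ {x | ⟪α, x⟫ = t})).toReal
          ^ ((1 : ℝ) / ((d : ℝ) - 1))) := by
  obtain ⟨n, rfl⟩ : ∃ n, d = n + 1 := ⟨d - 1, by omega⟩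
  have hn : 0 < n := by omega
  have hcast : (((n + 1 : ℕ) : ℝ) - 1) = n := by push_cast; ring
  rw [hcast]
  have hfin : Module.finrank ℝ (ℝ ∙ α)ᗮ = n := by
    have : Fact (Module.finrank ℝ (EuclideanSpace ℝ (Fin (n+1))) = n + 1) := ⟨by simp⟩
    exact Submodule.finrank_orthogonal_span_singleton hα
  let L : (Fin n → ℝ) ≃L[ℝ] (ℝ ∙ α)ᗮ := ContinuousLinearEquiv.ofFinrankEq (by simp [hfin])
  have hH : (Measure.hausdorffMeasure (n : ℝ) : Measure (ℝ ∙ α)ᗮ).IsAddHaarMeasure := by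
    have := isAddHaarMeasure_hausdorffMeasure (E := (ℝ ∙ α)ᗮ)
    rwa [hfin] at this
  let μ : Measure (Fin n → ℝ) := Measure.map L.symm (Measure.hausdorffMeasure (n : ℝ))
  have hμ : μ.IsAddHaarMeasure := L.symm.isAddHaarMeasure_map _
  obtain ⟨β, hβ⟩ : ∃ β, ⟪α, β⟫ = 1 := by
    refine ⟨(⟪α, α⟫)⁻¹ • α, ?_⟩
    rw [inner_smul_right, inv_mul_cancel₀ (inner_self_ne_zero.2 hα)]
  have hperp : ∀ w : (ℝ ∙ α)ᗮ, ⟪α, (w : EuclideanSpace ℝ (Fin (n+1)))⟫ = 0 := fun w =>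
    (Submodule.mem_orthogonal_singleton_iff_inner_right).1 w.2
  have hval : ∀ (t : ℝ) (w : (ℝ ∙ α)ᗮ), ⟪α, t • β + (w : EuclideanSpace ℝ (Fin (n+1)))⟫ = t := by
    intro t w
    rw [inner_add_right, inner_smul_right, hβ, hperp]; ring
  let φ : ℝ → (ℝ ∙ α)ᗮ → EuclideanSpace ℝ (Fin (n+1)) := fun t w => t • β + w
  have hφ : ∀ t, Isometry (φ t) := fun t =>
    (IsometryEquiv.addLeft (t • β)).isometry.comp isometry_subtype_coe
  have himg : ∀ t, K ∩ {x | ⟪α, x⟫ = t} = φ t '' (φ t ⁻¹' K) := by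
    intro t
    rw [Set.image_preimage_eq_inter_range]
    congr 1
    ext x
    constructor
    · intro hx
      have hx : ⟪α, x⟫ = t := hx
      refine ⟨⟨x - t • β, ?_⟩, by simp [φ]⟩
      rw [Submodule.mem_orthogonal_singleton_iff_inner_right, inner_sub_right, inner_smul_right,
        hβ, hx]; ring
    · rintro ⟨w, rfl⟩
      exact hval t w
  have hcomp : ∀ t, IsCompact (φ t ⁻¹' K) := by
    intro t
    have h1 := (hφ t).isClosedEmbedding.isCompact_preimage (hcompact t)
    have h2 : φ t ⁻¹' K = φ t ⁻¹' (K ∩ {x | ⟪α, x⟫ ≤ t}) :=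
      Set.Subset.antisymm (fun w h => ⟨h, (hval t w).le⟩) (fun w h => h.1)
    rw [h2]; exact h1
  have hmeas : ∀ t, Measure.hausdorffMeasure (n : ℝ) (K ∩ {x | ⟪α, x⟫ = t})
      = μ (L ⁻¹' (φ t ⁻¹' K)) := by
    intro t
    rw [himg, (hφ t).hausdorffMeasure_image (Or.inl (by positivity))]
    have m : MeasurableSet (L ⁻¹' (φ t ⁻¹' K)) :=
      (hcomp t).measurableSet.preimage L.continuous.measurable
    rw [Measure.map_apply L.symm.continuous.measurable m]
    congr 1
    ext w
    simp
  simp only [hmeas]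
  have hcomp' : ∀ t, IsCompact (L ⁻¹' (φ t ⁻¹' K)) := fun t =>
    L.toHomeomorph.isCompact_preimage.2 (hcomp t)
  have hne : ∀ t, ((∃ x ∈ K, ⟪α, x⟫ < t) ∧ ∃ x ∈ K, t < ⟪α, x⟫) →
      (L ⁻¹' (φ t ⁻¹' K)).Nonempty := by
    intro t ht
    obtain ⟨x, hx, hxt⟩ := section_nonempty hconv α ht
    have : x ∈ φ t '' (φ t ⁻¹' K) := by rw [← himg]; exact ⟨hx, hxt⟩
    obtain ⟨w, hw, -⟩ := this
    exact ⟨L.symm w, by simpa using hw⟩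
  rw [concaveOn_iff_forall_pos]
  constructor
  · apply Set.OrdConnected.convex
    refine ⟨?_⟩
    rintro s ⟨⟨x, hx, hxs⟩, -⟩ t ⟨-, ⟨y, hy, hyt⟩⟩ r hr
    exact ⟨⟨x, hx, hxs.trans_le hr.1⟩, ⟨y, hy, hr.2.trans_lt hyt⟩⟩
  · intro s hs t ht a b ha hb hab
    refine bm_haar hn μ (hcomp' s) (hcomp' t) (hcomp' _) (hne s hs) (hne t ht) ha hb ?_
    intro x hx y hy
    have := hconv hx hy ha.le hb.le hab
    have e : φ (a • s + b • t) (L (a • x + b • y)) = a • φ s (L x) + b • φ t (L y) := by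
      simp only [φ, map_add, map_smul, Submodule.coe_add, Submodule.coe_smul, smul_add, add_smul,
        smul_smul, smul_eq_mul]
      abel
    show φ _ (L _) ∈ K
    rw [e]; exact this
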